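/- arXiv:2408.02385 — 5 statements merged into one kernel-verified Lean document; each statement's English description precedes it below -/
import Mathlib

section
/- Let (X,d) be a metric space (of arbitrary cardinality). The following are equivalent: (i) there is a connected graph G such that (X,d) is isometric to a subspace of (V(G), d_G), i.e., there is an injective map Φ : X → V(G) with d(x,y) = d_G(Φ(x),Φ(y)) for all x, y ∈ X; (ii) d(p,q) is a non-negative integer for all p, q ∈ X. -/
/-- The integer-valued functions at bounded distance from `c`; two distinct functions are adjacent
when they differ by at most one everywhere. -/
def supLatticeGraph {ι : Type*} (c : ι → ℤ) :
    SimpleGraph {f : ι → ℤ // ∃ N : ℕ, ∀ z, |f z - c z| ≤ N} where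
  Adj f g := f ≠ g ∧ ∀ z, |f.1 z - g.1 z| ≤ 1
  symm := ⟨fun f g h => ⟨h.1.symm, fun z => by rw [abs_sub_comm]; exact h.2 z⟩⟩
  loopless := ⟨fun _ h => h.1 rfl⟩

namespace supLatticeGraph

variable {ι : Type*} {c : ι → ℤ}

lemma abs_sub_le_length {f g : {f : ι → ℤ // ∃ N : ℕ, ∀ z, |f z - c z| ≤ N}}
    (p : (supLatticeGraph c).Walk f g) (z : ι) : |f.1 z - g.1 z| ≤ p.length := by
  induction p with
  | nil => simp
  | @cons u v w h p ih =>
    have h₁ := h.2 z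
    have h₂ := abs_sub_le (u.1 z) (v.1 z) (w.1 z)
    rw [SimpleGraph.Walk.length_cons]
    push_cast
    linarith

lemma exists_walk_length_le (n : ℕ) (f g : {f : ι → ℤ // ∃ N : ℕ, ∀ z, |f z - c z| ≤ N})
    (h : ∀ z, |f.1 z - g.1 z| ≤ n) : ∃ p : (supLatticeGraph c).Walk f g, p.length ≤ n := by
  induction n generalizing f with
  | zero =>
    obtain rfl : f = g := Subtype.ext <| funext fun z => by
      have := h z
      rw [abs_le] at this
      push_cast at this
      omega
    exact ⟨.nil, le_rfl⟩
  | succ n ih =>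
    let k : ι → ℤ := fun z => f.1 z + (g.1 z - f.1 z).sign
    have step (z : ι) : |f.1 z - k z| ≤ 1 ∧ |k z - g.1 z| ≤ n := by
      have hz := h z
      simp only [k, abs_le] at hz ⊢
      push_cast at hz
      rcases lt_trichotomy (g.1 z - f.1 z) 0 with hs | hs | hs
      · rw [Int.sign_eq_neg_one_of_neg hs]; omega
      · rw [hs, Int.sign_zero]; omega
      · rw [Int.sign_eq_one_of_pos hs]; omega
    obtain ⟨N, hN⟩ := f.2
    have hk : ∃ N : ℕ, ∀ z, |k z - c z| ≤ N := ⟨N + 1, fun z => by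
      have h₁ := (step z).1
      have h₂ := abs_sub_le (k z) (f.1 z) (c z)
      rw [abs_sub_comm (k z) (f.1 z)] at h₂
      have h₃ := hN z
      push_cast
      linarith⟩
    obtain ⟨p, hp⟩ := ih ⟨k, hk⟩ fun z => (step z).2
    by_cases hfk : f = ⟨k, hk⟩
    · rw [hfk]
      exact ⟨p, by omega⟩
    · have hadj : (supLatticeGraph c).Adj f ⟨k, hk⟩ := ⟨hfk, fun z => (step z).1⟩
      exact ⟨.cons hadj p, by simpa using hp⟩

lemma connected (c : ι → ℤ) : (supLatticeGraph c).Connected where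
  preconnected f g := by
    obtain ⟨N, hN⟩ := f.2
    obtain ⟨M, hM⟩ := g.2
    obtain ⟨p, -⟩ := exists_walk_length_le (N + M) f g fun z => by
      have h₁ := abs_sub_le (f.1 z) (c z) (g.1 z)
      rw [abs_sub_comm (c z)] at h₁
      have h₂ := hN z
      have h₃ := hM z
      push_cast
      linarith
    exact p.reachable
  nonempty := ⟨⟨c, 0, by simp⟩⟩

lemma dist_eq {n : ℕ} {f g : {f : ι → ℤ // ∃ N : ℕ, ∀ z, |f z - c z| ≤ N}}
    (h : ∀ z, |f.1 z - g.1 z| ≤ n) (z : ι) (hz : |f.1 z - g.1 z| = n) :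
    (supLatticeGraph c).dist f g = n := by
  apply le_antisymm
  · obtain ⟨p, hp⟩ := exists_walk_length_le n f g h
    exact (SimpleGraph.dist_le p).trans hp
  · obtain ⟨p, hp⟩ := (connected c).exists_walk_length_eq_dist f g
    have := abs_sub_le_length p z
    rw [hz, hp] at this
    exact_mod_cast this

end supLatticeGraph

/-- A metric space is isometric to a subspace of the vertex set of a connected graph with
the geodesic distance iff all its distances are non-negative integers. -/
theorem metric_isometrically_embeds_in_graph_iff {X : Type u} [MetricSpace X] :
    (∃ (V : Type u) (G : SimpleGraph V), G.Connected ∧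
        ∃ Φ : X → V, Function.Injective Φ ∧
          ∀ x y : X, dist x y = (G.dist (Φ x) (Φ y) : ℝ)) ↔
      (∀ p q : X, ∃ n : ℕ, dist p q = (n : ℝ)) := by
  refine ⟨fun ⟨_, G, _, Φ, _, h⟩ p q => ⟨G.dist (Φ p) (Φ q), h p q⟩, fun h => ?_⟩
  choose D hD using h
  rcases isEmpty_or_nonempty X with hX | ⟨⟨x₀⟩⟩
  · exact ⟨PUnit, ⊥, .of_subsingleton, isEmptyElim, fun x => isEmptyElim x,
      fun x => isEmptyElim x⟩
  have bound (x y z : X) : |(D x z : ℤ) - D y z| ≤ D x y := by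
    have := abs_dist_sub_le x y z
    rw [hD, hD, hD] at this
    exact_mod_cast this
  have self (x : X) : D x x = 0 := by
    have := hD x x
    rw [dist_self] at this
    exact_mod_cast this.symm
  let Φ (x : X) : {f : X → ℤ // ∃ N : ℕ, ∀ z, |f z - D x₀ z| ≤ N} :=
    ⟨fun z => D x z, D x x₀, bound x x₀⟩
  have dist_Φ (x y : X) : dist x y = ((supLatticeGraph _).dist (Φ x) (Φ y) : ℝ) := by
    rw [hD, supLatticeGraph.dist_eq (bound x y) y (by simp [Φ, self])]
  refine ⟨_, supLatticeGraph _, supLatticeGraph.connected _, Φ, fun x y hxy => ?_, dist_Φ⟩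
  rw [← dist_eq_zero, dist_Φ, hxy, SimpleGraph.dist_self, Nat.cast_zero]
end

section
/- For every metric space (X,d) there exist a connected graph G and an injective mapping Φ : X → V(G) such that d(x,y) ≤ d_G(Φ(x),Φ(y)) < d(x,y) + 1 for all x, y ∈ X. -/
/-- The integer-valued functions on `X` at finite uniform distance from every rounded distance
function `⌈d(x, ·)⌉`. -/
def RoundedDistSpace (X : Type*) [MetricSpace X] : Type _ :=
  {f : X → ℤ // ∀ x, ∃ n : ℕ, ∀ z, |f z - ⌈dist x z⌉| ≤ n}

/-- Two functions are adjacent when they differ, by at most `1` at every point. -/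
def roundedDistGraph (X : Type*) [MetricSpace X] : SimpleGraph (RoundedDistSpace X) where
  Adj f g := f ≠ g ∧ ∀ z, |f.1 z - g.1 z| ≤ 1
  symm := ⟨fun _ _ h => ⟨h.1.symm, fun z => (abs_sub_comm _ _).trans_le (h.2 z)⟩⟩
  loopless := ⟨fun _ h => h.1 rfl⟩

theorem abs_ceil_dist_sub_le {X : Type*} [MetricSpace X] (x y z : X) :
    |⌈dist x z⌉ - ⌈dist y z⌉| ≤ ⌈dist x y⌉ := by
  have h₁ : ⌈dist x z⌉ ≤ ⌈dist x y⌉ + ⌈dist y z⌉ :=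
    (Int.ceil_mono (dist_triangle x y z)).trans (Int.ceil_add_le _ _)
  have h₂ : ⌈dist y z⌉ ≤ ⌈dist x y⌉ + ⌈dist x z⌉ :=
    (Int.ceil_mono (dist_triangle_left y z x |>.trans (by rw [dist_comm x y, dist_comm x z]))).trans
      (Int.ceil_add_le _ _)
  rw [abs_le]
  constructor <;> linarith

/-- The rounded Kuratowski embedding `x ↦ ⌈d(x, ·)⌉`. -/
noncomputable def roundedDist {X : Type*} [MetricSpace X] (x : X) : RoundedDistSpace X :=
  ⟨fun z => ⌈dist x z⌉, fun y => ⟨⌈dist x y⌉.toNat, fun z =>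
    (abs_ceil_dist_sub_le x y z).trans (Int.self_le_toNat _)⟩⟩

theorem abs_sub_le_walk_length {X : Type*} [MetricSpace X] {f g : RoundedDistSpace X}
    (p : (roundedDistGraph X).Walk f g) (z : X) : |f.1 z - g.1 z| ≤ p.length := by
  induction p with
  | nil => simp
  | cons h p ih =>
    rw [SimpleGraph.Walk.length_cons]
    have := h.2 z
    push_cast
    exact (abs_sub_le _ _ _).trans (by linarith)

theorem exists_walk_length_le {X : Type*} [MetricSpace X] (n : ℕ) (f g : RoundedDistSpace X)
    (h : ∀ z, |f.1 z - g.1 z| ≤ n) :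
    ∃ p : (roundedDistGraph X).Walk f g, p.length ≤ n := by
  induction n generalizing f with
  | zero =>
    obtain rfl : f = g := Subtype.ext <| funext fun z => by
      have := h z
      rw [Nat.cast_zero, abs_nonpos_iff] at this
      linarith
    exact ⟨.nil, le_rfl⟩
  | succ n ih =>
    let k : RoundedDistSpace X := ⟨fun z => f.1 z + max (-1) (min 1 (g.1 z - f.1 z)), fun x => by
      obtain ⟨m, hm⟩ := f.2 x
      refine ⟨m + 1, fun z => ?_⟩
      have := hm z
      rw [abs_le] at this ⊢
      push_cast
      omega⟩
    have hk : ∀ z, k.1 z = f.1 z + max (-1) (min 1 (g.1 z - f.1 z)) := fun _ => rfl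
    obtain ⟨p, hp⟩ := ih k fun z => by
      have := h z
      rw [abs_le] at this ⊢
      rw [hk]
      push_cast at this
      omega
    by_cases hfk : f = k
    · rw [hfk]
      exact ⟨p, by omega⟩
    · have hadj : (roundedDistGraph X).Adj f k := ⟨hfk, fun z => by
        rw [hk, abs_le]
        omega⟩
      exact ⟨.cons hadj p, by rw [SimpleGraph.Walk.length_cons]; omega⟩

theorem roundedDistGraph_connected (X : Type*) [MetricSpace X] :
    (roundedDistGraph X).Connected := by
  rcases isEmpty_or_nonempty X with hX | ⟨⟨x⟩⟩
  · have : Nonempty (RoundedDistSpace X) := ⟨⟨fun _ => 0, fun x => isEmptyElim x⟩⟩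
    refine ⟨fun f g => ?_⟩
    obtain ⟨p, -⟩ := exists_walk_length_le 0 f g fun z => isEmptyElim z
    exact p.reachable
  · have : Nonempty (RoundedDistSpace X) := ⟨roundedDist x⟩
    refine ⟨fun f g => ?_⟩
    obtain ⟨m, hm⟩ := f.2 x
    obtain ⟨n, hn⟩ := g.2 x
    obtain ⟨p, -⟩ := exists_walk_length_le (m + n) f g fun z => by
      have h₁ := hm z
      have h₂ := hn z
      rw [abs_le] at h₁ h₂ ⊢
      push_cast
      omega
    exact p.reachable

theorem dist_roundedDist {X : Type*} [MetricSpace X] (x y : X) :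
    ((roundedDistGraph X).dist (roundedDist x) (roundedDist y) : ℤ) = ⌈dist x y⌉ := by
  have hxy : (0 : ℤ) ≤ ⌈dist x y⌉ := Int.ceil_nonneg dist_nonneg
  apply le_antisymm
  · obtain ⟨p, hp⟩ := exists_walk_length_le ⌈dist x y⌉.toNat (roundedDist x) (roundedDist y)
      fun z => (abs_ceil_dist_sub_le x y z).trans (Int.self_le_toNat _)
    have := (roundedDistGraph X).dist_le p
    omega
  · obtain ⟨p, hp⟩ := (roundedDistGraph_connected X).exists_walk_length_eq_dist
      (roundedDist x) (roundedDist y)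
    have := abs_sub_le_walk_length p y
    rw [hp] at this
    simpa [roundedDist, abs_of_nonneg hxy] using this

theorem roundedDist_injective (X : Type*) [MetricSpace X] :
    Function.Injective (roundedDist : X → RoundedDistSpace X) := by
  intro x y h
  have hd := dist_roundedDist x y
  rw [h, SimpleGraph.dist_self, Nat.cast_zero] at hd
  exact dist_le_zero.mp (by simpa [← hd] using Int.le_ceil (dist x y))

/-- For every metric space `(X, d)` there are a connected graph `G` and an injective map
`Φ : X → V(G)` with `d(x,y) ≤ d_G(Φ x, Φ y) < d(x,y) + 1` for all `x, y ∈ X`. -/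
theorem exists_graph_almost_isometric_embedding {X : Type u} [MetricSpace X] :
    ∃ (V : Type u) (G : SimpleGraph V) (Φ : X → V), G.Connected ∧
      Function.Injective Φ ∧
      ∀ x y : X, dist x y ≤ (G.dist (Φ x) (Φ y) : ℝ) ∧
        (G.dist (Φ x) (Φ y) : ℝ) < dist x y + 1 := by
  refine ⟨RoundedDistSpace X, roundedDistGraph X, roundedDist, roundedDistGraph_connected X,
    roundedDist_injective X, fun x y => ?_⟩
  rw [← Int.cast_natCast, dist_roundedDist]
  exact ⟨Int.le_ceil _, Int.ceil_lt_add_one _⟩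
end

section
/- Let (Y,ρ) be a metric space with at least 5 points such that for all x, y, z ∈ Y, if ρ(x,z) ≥ max{ρ(x,y), ρ(y,z)} then ρ(x,z) = ρ(x,y) + ρ(y,z). Then (Y,ρ) is isometric to a subspace of the real line ℝ (with the standard metric); i.e., there is an isometric embedding of (Y,ρ) into ℝ. -/
/-- In every triple, one of the three distances is the sum of the other two. -/
theorem dist_eq_add_trichotomy {Y : Type*} [MetricSpace Y]
    (hMB : ∀ x y z : Y, max (dist x y) (dist y z) ≤ dist x z →
      dist x z = dist x y + dist y z) (x y z : Y) :
    dist x z = dist x y + dist y z ∨ dist x y = dist x z + dist y z ∨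
      dist y z = dist x y + dist x z := by
  have h₁ := hMB x y z
  have h₂ := hMB x z y
  have h₃ := hMB y x z
  rw [dist_comm z y] at h₂
  rw [dist_comm y x] at h₃
  simp only [max_le_iff] at h₁ h₂ h₃
  rcases le_total (dist x y) (dist x z) with h | h <;>
    rcases le_total (dist x y) (dist y z) with h' | h' <;>
    rcases le_total (dist x z) (dist y z) with h'' | h'' <;>
    first
    | exact Or.inl (h₁ ⟨by linarith, by linarith⟩)
    | exact Or.inr (Or.inl (h₂ ⟨by linarith, by linarith⟩))
    | exact Or.inr (Or.inr (h₃ ⟨by linarith, by linarith⟩))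

/-- The distances `w, x, y, z` from a fifth point to a pseudo-linear quadruple, whose consecutive
distances are `A, B, A, B` and whose diagonals are `A + B`, cannot all be positive. -/
theorem no_fifth_point_of_pseudolinear {A B w x y z : ℝ} (hA : 0 < A) (hB : 0 < B)
    (hw : 0 < w) (hx : 0 < x) (hy : 0 < y) (hz : 0 < z)
    (hwx : A = w + x ∨ w = A + x ∨ x = w + A)
    (hxy : B = x + y ∨ x = B + y ∨ y = x + B)
    (hyz : A = y + z ∨ y = A + z ∨ z = y + A)
    (hwz : B = w + z ∨ w = B + z ∨ z = w + B)
    (hwy : A + B = w + y ∨ w = A + B + y ∨ y = w + (A + B))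
    (hxz : A + B = x + z ∨ x = A + B + z ∨ z = x + (A + B)) : False := by
  rcases hwy with h₁ | h₁ | h₁ <;> rcases hxz with h₂ | h₂ | h₂ <;>
    rcases hwx with h₃ | h₃ | h₃ <;> try linarith
  all_goals rcases hyz with h₄ | h₄ | h₄ <;> try linarith
  all_goals rcases hxy with h₅ | h₅ | h₅ <;> try linarith
  all_goals rcases hwz with h₆ | h₆ | h₆ <;> linarith

/-- A collinear space with at least five points contains no four distinct points whose opposite
distances agree. -/
theorem no_equal_opposite_distances {Y : Type*} [MetricSpace Y]
    (h5 : 5 ≤ Cardinal.mk Y)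
    (hT : ∀ x y z : Y, dist x z = dist x y + dist y z ∨ dist x y = dist x z + dist y z ∨
      dist y z = dist x y + dist x z)
    {p q r s : Y} (hpq : p ≠ q) (hpr : p ≠ r) (hps : p ≠ s)
    (h₁ : dist r s = dist p q) (h₂ : dist q s = dist p r) (h₃ : dist q r = dist p s) :
    False := by
  classical
  obtain ⟨e, he⟩ : ∃ e : Y, e ∉ ({p, q, r, s} : Finset Y) := by
    by_contra! h
    have hle : Cardinal.mk Y ≤ 4 := by
      have hu : (Set.univ : Set Y) = (({p, q, r, s} : Finset Y) : Set Y) :=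
        (Set.eq_univ_of_forall h).symm
      rw [← Cardinal.mk_univ, hu]
      refine Cardinal.mk_coe_finset.trans_le ?_
      exact_mod_cast Finset.card_le_four
    have h54 : (5 : Cardinal) ≤ 4 := h5.trans hle
    exact absurd (by exact_mod_cast h54 : (5 : ℕ) ≤ 4) (by norm_num)
  simp only [Finset.mem_insert, Finset.mem_singleton, not_or] at he
  obtain ⟨hp, hq, hr, hs⟩ := he
  have key : ∀ u v : Y, dist u v = dist e u + dist e v ∨ dist e u = dist u v + dist e v ∨
      dist e v = dist e u + dist u v := by
    intro u v
    rcases hT e u v with h | h | h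
    · exact Or.inr (Or.inr h)
    · exact Or.inr (Or.inl (by linarith))
    · exact Or.inl h
  have kpq := key p q
  have kpr := key p r
  have kps := key p s
  have kqr := key q r
  have kqs := key q s
  have krs := key r s
  have krq := key r q
  have ksq := key s q
  rw [dist_comm r q] at krq
  rw [dist_comm s q] at ksq
  rw [h₁] at krs
  rw [h₂] at kqs ksq
  rw [h₃] at kqr krq
  have dpq := dist_pos.2 hpq
  have dpr := dist_pos.2 hpr
  have dps := dist_pos.2 hps
  replace hp := dist_pos.2 hp
  replace hq := dist_pos.2 hq
  replace hr := dist_pos.2 hr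
  replace hs := dist_pos.2 hs
  have hpqr := hT p q r
  rw [h₃] at hpqr
  rcases hpqr with h | h | h
  · rw [h] at kpr kqs
    exact no_fifth_point_of_pseudolinear dpq dps hp hq hr hs kpq kqr krs kps kpr kqs
  · rw [h] at kpq krs
    exact no_fifth_point_of_pseudolinear dpr dps hp hr hq hs kpr krq kqs kps kpq krs
  · rw [h, add_comm (dist p q)] at kps krq
    exact no_fifth_point_of_pseudolinear dpr dpq hp hr hs hq kpr krs ksq kpq kps krq

/-- Menger: a metric space with at least five points, in which `ρ(x,z) = ρ(x,y) + ρ(y,z)`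
holds whenever `ρ(x,z) ≥ max (ρ(x,y)) (ρ(y,z))`, embeds isometrically into `ℝ`. -/
theorem menger_embedding_in_real_line {Y : Type*} [MetricSpace Y]
    (h5 : 5 ≤ Cardinal.mk Y)
    (hMB : ∀ x y z : Y, max (dist x y) (dist y z) ≤ dist x z →
      dist x z = dist x y + dist y z) :
    ∃ Φ : Y → ℝ, ∀ x y : Y, dist x y = |Φ x - Φ y| := by
  have hT := dist_eq_add_trichotomy hMB
  rcases subsingleton_or_nontrivial Y with hY | hY
  · exact ⟨fun _ => 0, fun x y => by simp [Subsingleton.elim x y]⟩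
  obtain ⟨a, b, hab⟩ := exists_pair_ne Y
  have hd : 0 < dist a b := dist_pos.2 hab
  have hΦ : ∀ x : Y, ∃ t : ℝ, dist a x = |t| ∧ dist b x = |t - dist a b| := by
    intro x
    have hax : 0 ≤ dist a x := dist_nonneg
    have hbx : 0 ≤ dist b x := dist_nonneg
    rcases hT a b x with h | h | h
    · exact ⟨dist a x, by rw [abs_of_nonneg hax], by rw [abs_of_nonneg] <;> linarith⟩
    · exact ⟨dist a x, by rw [abs_of_nonneg hax], by rw [abs_of_nonpos] <;> linarith⟩
    · exact ⟨-dist a x, by rw [abs_neg, abs_of_nonneg hax], by rw [abs_of_nonpos] <;> linarith⟩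
  choose Φ hΦa hΦb using hΦ
  refine ⟨Φ, fun x y => ?_⟩
  have fold : ∀ u v D : ℝ, 0 ≤ D → (D = |u| + |v| ∨ |u| = D + |v| ∨ |v| = |u| + D) →
      D = |u - v| ∨ D = |u + v| := by
    intro u v D hD h
    grind
  by_contra hne
  have ha : dist x y = |Φ x + Φ y| := by
    refine (fold (Φ x) (Φ y) _ dist_nonneg ?_).resolve_left hne
    rw [← hΦa, ← hΦa]
    rcases hT a x y with h | h | h
    · exact Or.inr (Or.inr h)
    · exact Or.inr (Or.inl (by linarith))
    · exact Or.inl h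
  have hb : dist x y = |(Φ x - dist a b) + (Φ y - dist a b)| := by
    refine (fold (Φ x - dist a b) (Φ y - dist a b) _ dist_nonneg ?_).resolve_left
      (by rwa [sub_sub_sub_cancel_right])
    rw [← hΦb, ← hΦb]
    rcases hT b x y with h | h | h
    · exact Or.inr (Or.inr h)
    · exact Or.inr (Or.inl (by linarith))
    · exact Or.inl h
  have hsum : Φ x + Φ y = dist a b := by
    rcases abs_eq_abs.1 (ha.symm.trans hb) with h | h <;> linarith
  have hxy : dist x y = dist a b := by rw [ha, hsum, abs_of_pos hd]
  have hby : dist b y = dist a x := by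
    rw [hΦa, hΦb, ← abs_neg]; congr 1; linarith
  have hbx : dist b x = dist a y := by
    rw [hΦa, hΦb, ← abs_neg]; congr 1; linarith
  refine no_equal_opposite_distances h5 hT hab ?_ ?_ hxy hby hbx
  · rintro rfl
    have h0 : Φ a = 0 := abs_eq_zero.1 (by rw [← hΦa, dist_self])
    exact hne (by rw [h0, zero_sub, abs_neg, ← hΦa])
  · rintro rfl
    have h0 : Φ a = 0 := abs_eq_zero.1 (by rw [← hΦa, dist_self])
    exact hne (by rw [h0, sub_zero, ← hΦa, dist_comm])
end

section
/- Let (X,d) be a four-point metric space such that for all x, y, z ∈ X, if d(x,z) ≥ max{d(x,y), d(y,z)} then d(x,z) = d(x,y) + d(y,z). Then (X,d) cannot be isometrically embedded in the real line ℝ if and only if the points of X can be labelled x₁, x₂, x₃, x₄ so that there exist positive constants s and t with d(x₁,x₂) = d(x₃,x₄) = s, d(x₂,x₃) = d(x₁,x₄) = t, and d(x₁,x₃) = d(x₂,x₄) = s + t. -/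
/-- In a triple where the largest distance is the sum of the other two, each distance is either
the sum or the absolute difference of the other two. -/
theorem dist_eq_add_or_eq_abs_sub {X : Type*} [MetricSpace X]
    (hMB : ∀ x y z : X, max (dist x y) (dist y z) ≤ dist x z →
      dist x z = dist x y + dist y z) (x u v : X) :
    dist u v = dist x u + dist x v ∨ dist u v = |dist x u - dist x v| := by
  have h₁ := hMB u x v
  have h₂ := hMB x u v
  have h₃ := hMB x v u
  rw [dist_comm u x, max_le_iff] at h₁
  rw [max_le_iff] at h₂
  rw [dist_comm v u, max_le_iff] at h₃
  have := dist_nonneg (x := u) (y := v)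
  grind


/-- Menger: a four-point metric space in which `d(x,z) = d(x,y) + d(y,z)` holds whenever
`d(x,z) ≥ max (d(x,y)) (d(y,z))` cannot be isometrically embedded in `ℝ` iff its points
can be labelled `x₁, x₂, x₃, x₄` so as to form a pseudo-linear quadruple. -/
theorem four_point_not_embeddable_iff_pseudo_linear {X : Type*} [MetricSpace X]
    [Fintype X] (hcard : Fintype.card X = 4)
    (hMB : ∀ x y z : X, max (dist x y) (dist y z) ≤ dist x z →
      dist x z = dist x y + dist y z) :
    (¬ ∃ Φ : X → ℝ, ∀ x y : X, dist x y = |Φ x - Φ y|) ↔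
      ∃ x₁ x₂ x₃ x₄ : X, ({x₁, x₂, x₃, x₄} : Set X) = Set.univ ∧
        ∃ s t : ℝ, 0 < s ∧ 0 < t ∧
          dist x₁ x₂ = s ∧ dist x₃ x₄ = s ∧
          dist x₂ x₃ = t ∧ dist x₁ x₄ = t ∧
          dist x₁ x₃ = s + t ∧ dist x₂ x₄ = s + t := by
  constructor
  · intro hne
    have : Nonempty X := Fintype.card_pos_iff.mp (by omega)
    obtain ⟨⟨x, y⟩, hmax⟩ := Finite.exists_max (fun p : X × X => dist p.1 p.2)
    have hD : ∀ w, dist x y = dist x w + dist w y := fun w =>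
      hMB x w y (max_le (hmax (x, w)) (hmax (w, y)))
    have hex : ∃ u v, dist u v ≠ |dist x u - dist x v| := by
      by_contra! h
      exact hne ⟨dist x, h⟩
    obtain ⟨u, v, huv⟩ := hex
    have huv_ne : u ≠ v := by
      rintro rfl
      simp at huv
    have hxu : x ≠ u := by
      rintro rfl
      simp at huv
    have hxv : x ≠ v := by
      rintro rfl
      simp [dist_comm] at huv
    have hadd := (dist_eq_add_or_eq_abs_sub hMB x u v).resolve_right huv
    have hpu := dist_pos.mpr hxu
    have hpv := dist_pos.mpr hxv
    have hDu := hD u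
    have hDv := hD v
    have hyu : u ≠ y := by
      rintro rfl
      rw [dist_comm v u] at hDv
      linarith
    have hyv : v ≠ y := by
      rintro rfl
      linarith
    have hxy : x ≠ y := by
      rintro rfl
      have := hmax (x, u)
      simp only [dist_self] at this
      linarith
    have hsum : dist x u + dist x v = dist x y := by
      have h := dist_eq_add_or_eq_abs_sub hMB y u v
      rw [dist_comm y u, dist_comm y v] at h
      grind
    refine ⟨x, u, y, v, ?_, dist x u, dist x v, hpu, hpv, rfl, ?_, ?_, rfl, hsum.symm, hadd⟩
    · classical
      have hc : ({x, u, y, v} : Finset X).card = Fintype.card X := by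
        rw [hcard]
        simp [*, hyv.symm]
      simpa using congrArg (fun s : Finset X => (s : Set X)) (Finset.card_eq_iff_eq_univ _ |>.mp hc)
    · rw [dist_comm y v]
      linarith
    · linarith
  · rintro ⟨a, b, c, d, -, s, t, hs, ht, hab, hcd, hbc, had, hac, hbd⟩ ⟨Φ, hΦ⟩
    rw [hΦ] at hab hcd hbc had hac hbd
    grind
end

section
/- Let (X,d) be a metric space and let x₁, x₂, x₃, x₄ ∈ X be four points. Set p = d(x₁,x₂) + d(x₂,x₃) + d(x₃,x₄) + d(x₄,x₁). Then d(x₁,x₃)·d(x₂,x₄) − d(x₁,x₂)·d(x₃,x₄) − d(x₄,x₁)·d(x₂,x₃) ≤ p²/8. -/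
/-- If `u ≤ a + b`, `v ≤ a + e` and `a ≤ c` for nonnegative reals, then
`u * v - a * c - e * b` is at most an eighth of the square of `a + b + c + e`. -/
theorem mul_sub_mul_sub_mul_le_sq_div_eight {a b c e u v : ℝ} (ha : 0 ≤ a) (hb : 0 ≤ b)
    (he : 0 ≤ e) (hv : 0 ≤ v) (hac : a ≤ c) (hu : u ≤ a + b) (hve : v ≤ a + e) :
    u * v - a * c - e * b ≤ (a + b + c + e) ^ 2 / 8 := by
  have huv : u * v ≤ (a + b) * (a + e) := mul_le_mul hu hve hv (by positivity)
  obtain ⟨t, ht, rfl⟩ : ∃ t, 0 ≤ t ∧ c = a + t := ⟨c - a, by linarith, by ring⟩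
  nlinarith [sq_nonneg (2 * a - (b + e)), sq_nonneg t, mul_nonneg ha ht, mul_nonneg hb ht,
    mul_nonneg he ht]

/-- For any four points of a metric space, with `p` the perimeter
`d(x₁,x₂) + d(x₂,x₃) + d(x₃,x₄) + d(x₄,x₁)`, one has
`d(x₁,x₃)·d(x₂,x₄) − d(x₁,x₂)·d(x₃,x₄) − d(x₄,x₁)·d(x₂,x₃) ≤ p²/8`. -/
theorem four_point_quadruple_inequality {X : Type*} [MetricSpace X]
    (x₁ x₂ x₃ x₄ : X) (p : ℝ)
    (hp : p = dist x₁ x₂ + dist x₂ x₃ + dist x₃ x₄ + dist x₄ x₁) :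
    dist x₁ x₃ * dist x₂ x₄ - dist x₁ x₂ * dist x₃ x₄ - dist x₄ x₁ * dist x₂ x₃
      ≤ p ^ 2 / 8 := by
  subst hp
  rcases le_total (dist x₁ x₂) (dist x₃ x₄) with h | h
  · refine mul_sub_mul_sub_mul_le_sq_div_eight dist_nonneg dist_nonneg dist_nonneg dist_nonneg h
      (dist_triangle x₁ x₂ x₃) ?_
    linarith [dist_triangle x₂ x₁ x₄, dist_comm x₂ x₁, dist_comm x₁ x₄]
  · have hu : dist x₁ x₃ ≤ dist x₃ x₄ + dist x₄ x₁ := by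
      linarith [dist_triangle x₁ x₄ x₃, dist_comm x₁ x₄, dist_comm x₄ x₃]
    have hv : dist x₂ x₄ ≤ dist x₃ x₄ + dist x₂ x₃ := by
      linarith [dist_triangle x₂ x₃ x₄]
    have key := mul_sub_mul_sub_mul_le_sq_div_eight dist_nonneg dist_nonneg dist_nonneg
      dist_nonneg h hu hv
    convert key using 1 <;> ring
end
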